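/- Let 1 < σ ≤ 1.15, set σ1 = 1/2 + (1/2)·√(1+4σ²), and let c ∈ {0,1}. Then (1/2)·Re( ψ((σ+c)/2) − κ·ψ((σ1+c)/2) ) ≤ −0.0512, where ψ = Γ'/Γ is the logarithmic derivative of the Gamma function. -/

import Mathlib

namespace ZFR

noncomputable def kappa : ℝ := 1 / Real.sqrt 5

noncomputable def sigma1 (σ : ℝ) : ℝ := 1 / 2 + Real.sqrt (1 + 4 * σ ^ 2) / 2

/-- `ψ = Γ'/Γ`, the logarithmic derivative of the complex Gamma function. -/
noncomputable def psi (s : ℂ) : ℂ := logDeriv Complex.Gamma s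

private lemma ofReal_ne_neg_nat {x : ℝ} (hx : 0 < x) (m : ℕ) : (x : ℂ) ≠ -m := by
  intro h
  have h' : x = -m := by exact_mod_cast h
  have := m.cast_nonneg (α := ℝ)
  linarith

lemma hasDerivAt_log_Gamma {x : ℝ} (hx : 0 < x) :
    HasDerivAt (Real.log ∘ Real.Gamma) (psi x).re x := by
  have h := (Complex.differentiableAt_Gamma x (ofReal_ne_neg_nat hx)).hasDerivAt.real_of_complex
  simp only [Complex.Gamma_ofReal, Complex.ofReal_re] at h
  rw [psi, logDeriv_apply, Complex.Gamma_ofReal, Complex.div_ofReal_re]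
  exact h.log (Real.Gamma_pos_of_pos hx).ne'

lemma log_Gamma_add_one_sub {x : ℝ} (hx : 0 < x) :
    Real.log (Real.Gamma (x + 1)) - Real.log (Real.Gamma x) = Real.log x := by
  rw [Real.Gamma_add_one hx.ne', Real.log_mul hx.ne' (Real.Gamma_pos_of_pos hx).ne']
  ring

lemma re_psi_le_log {x : ℝ} (hx : 0 < x) : (psi x).re ≤ Real.log x := by
  have h := Real.convexOn_log_Gamma.le_slope_of_hasDerivAt (x := x) (y := x + 1)
    hx (by simp; linarith) (by linarith) (hasDerivAt_log_Gamma hx)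
  simpa [slope_def_field, log_Gamma_add_one_sub hx] using h

lemma log_le_re_psi_add_one {x : ℝ} (hx : 0 < x) : Real.log x ≤ (psi (x + 1 : ℝ)).re := by
  have h := Real.convexOn_log_Gamma.slope_le_of_hasDerivAt (x := x) (y := x + 1)
    hx (by simp; linarith) (by linarith) (hasDerivAt_log_Gamma (by linarith))
  simpa [slope_def_field, log_Gamma_add_one_sub hx] using h

lemma re_psi_add_one {x : ℝ} (hx : 0 < x) : (psi (x + 1 : ℝ)).re = (psi x).re + 1 / x := by
  have h := congrArg Complex.re (Complex.digamma_apply_add_one x (ofReal_ne_neg_nat hx))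
  rw [Complex.add_re, ← Complex.ofReal_inv, Complex.ofReal_re] at h
  simpa [psi, Complex.digamma_def] using h

lemma re_psi_le {x : ℝ} (hx : 0 < x) :
    (psi x).re ≤ Real.log (x + 2) - 1 / x - 1 / (x + 1) := by
  have h := re_psi_le_log (show 0 < x + 1 + 1 by linarith)
  rw [re_psi_add_one (by linarith), re_psi_add_one hx, show x + 1 + 1 = x + 2 by ring] at h
  linarith

lemma le_re_psi {x : ℝ} (hx : 0 < x) :
    Real.log (x + 1) - 1 / x - 1 / (x + 1) ≤ (psi x).re := by
  have h := log_le_re_psi_add_one (show 0 < x + 1 by linarith)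
  rw [re_psi_add_one (by linarith), re_psi_add_one hx] at h
  linarith

lemma log_le_mul {x : ℝ} (hx : 0 < x) : Real.log x ≤ 0.368 * x := by
  have h := Real.log_le_sub_one_of_pos (show 0 < x / Real.exp 1 by positivity)
  rw [Real.log_div hx.ne' (Real.exp_pos 1).ne', Real.log_exp] at h
  have : x / Real.exp 1 ≤ 0.368 * x := by
    rw [div_le_iff₀ (Real.exp_pos 1)]
    nlinarith [Real.exp_one_gt_d9]
  linarith

lemma le_log_add_one {x : ℝ} (hx : 0 < x) : 1.693 - 2 / (x + 1) ≤ Real.log (x + 1) := by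
  have h := Real.one_sub_inv_le_log_of_pos (show 0 < (x + 1) / 2 by linarith)
  rw [Real.log_div (by linarith) two_ne_zero, inv_div] at h
  linarith [Real.log_two_gt_d9]

/-- Explicit upper bound for `ψ` on `(0, u]`. -/
lemma re_psi_le_of_le {x u : ℝ} (hx : 0 < x) (hu : x ≤ u) :
    (psi x).re ≤ 0.368 * (u + 2) - 1 / u - 1 / (u + 1) := by
  have h1 := re_psi_le hx
  have h2 := log_le_mul (show 0 < x + 2 by linarith)
  have h3 : 1 / u ≤ 1 / x := one_div_le_one_div_of_le hx hu
  have h4 : 1 / (u + 1) ≤ 1 / (x + 1) := one_div_le_one_div_of_le (by linarith) (by linarith)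
  linarith

/-- Explicit lower bound for `ψ` on `[l, ∞)`. -/
lemma le_re_psi_of_le {x l : ℝ} (hl : 0 < l) (hx : l ≤ x) :
    1.693 - 1 / l - 3 * (1 / (l + 1)) ≤ (psi x).re := by
  have h1 := le_re_psi (hl.trans_le hx)
  have h2 := le_log_add_one (hl.trans_le hx)
  have h3 : 1 / x ≤ 1 / l := one_div_le_one_div_of_le hl hx
  have h4 : 1 / (x + 1) ≤ 1 / (l + 1) := one_div_le_one_div_of_le (by linarith) (by linarith)
  have h5 : 2 / (x + 1) = 2 * (1 / (x + 1)) := by ring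
  linarith

lemma kappa_pos : 0 < kappa := by
  unfold kappa
  positivity

lemma kappa_le : kappa ≤ 0.4473 := by
  unfold kappa
  rw [div_le_iff₀ (by positivity)]
  have : (2.236 : ℝ) ≤ Real.sqrt 5 := Real.le_sqrt_of_sq_le (by norm_num)
  linarith

lemma le_sigma1 {σ : ℝ} (hσ : 1 < σ) : 1.6 ≤ sigma1 σ := by
  unfold sigma1
  have : (2.2 : ℝ) ≤ Real.sqrt (1 + 4 * σ ^ 2) := Real.le_sqrt_of_sq_le (by nlinarith)
  linarith

/-- For `1 < σ ≤ 1.15` and `c ∈ {0,1}`: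
`(1/2) Re( ψ((σ+c)/2) - κ ψ((σ1+c)/2) ) ≤ -0.0512`. -/
theorem gamma_term_real (σ c : ℝ) (hσ : 1 < σ) (hσ' : σ ≤ 1.15) (hc : c = 0 ∨ c = 1) :
    (1 / 2) * (psi (((σ + c) / 2 : ℝ) : ℂ)
        - (kappa : ℂ) * psi (((sigma1 σ + c) / 2 : ℝ) : ℂ)).re ≤ -0.0512 := by
  rw [Complex.sub_re, Complex.re_ofReal_mul]
  have hs := le_sigma1 hσ
  have hk := kappa_pos
  have hk' := kappa_le
  rcases hc with rfl | rfl
  · have hu := re_psi_le_of_le (x := (σ + 0) / 2) (u := 0.575) (by linarith) (by linarith)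
    have hl := le_re_psi_of_le (x := (sigma1 σ + 0) / 2) (l := 0.8) (by norm_num) (by linarith)
    have hm := mul_le_mul_of_nonneg_left hl hk.le
    norm_num at hu hm hk' ⊢
    linarith
  · have hu := re_psi_le_of_le (x := (σ + 1) / 2) (u := 1.075) (by linarith) (by linarith)
    have hl := le_re_psi_of_le (x := (sigma1 σ + 1) / 2) (l := 1.3) (by norm_num) (by linarith)
    have hm := mul_le_mul_of_nonneg_left hl hk.le
    norm_num at hu hm hk' ⊢
    linarith

end ZFR
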